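/- Let X be a real n×m matrix and let k be a positive integer with k < rank(X) such that every k columns of X are linearly independent. Then X is (k−1)-variation bounding if and only if X is k-sign consistent. -/

import Mathlib

open Matrix Polynomial Filter

noncomputable def signChanges (l : List ℝ) : ℕ :=
  (l.zip l.tail).countP (fun p => decide (p.1 * p.2 < 0))

/-- Variation `V(u)`: number of sign changes after deleting zero entries, `-1` for the
zero vector. -/
noncomputable def variation {m : ℕ} (u : Fin m → ℝ) : ℤ :=
  if ((List.ofFn u).filter fun x => decide (x ≠ 0)) = [] then -1
  else (signChanges ((List.ofFn u).filter fun x => decide (x ≠ 0)) : ℤ)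

/-- Maximal variation `V_z(u)`: largest number of sign changes obtainable by replacing every
zero entry of `u` by an arbitrary nonzero real number. -/
noncomputable def maxVariation {m : ℕ} (u : Fin m → ℝ) : ℤ :=
  sSup {v : ℤ | ∃ w : Fin m → ℝ, (∀ i, w i ≠ 0) ∧ (∀ i, u i ≠ 0 → w i = u i) ∧
    v = (signChanges (List.ofFn w) : ℤ)}

/-- `X` is strictly `k`-variation bounding. -/
def SVB {n m : ℕ} (X : Matrix (Fin n) (Fin m) ℝ) (k : ℕ) : Prop :=
  ∀ u : Fin m → ℝ, u ≠ 0 → variation u ≤ (k : ℤ) → maxVariation (X.mulVec u) ≤ (k : ℤ)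

/-- `X` is `k`-variation bounding. -/
def VB {n m : ℕ} (X : Matrix (Fin n) (Fin m) ℝ) (k : ℕ) : Prop :=
  ∀ u : Fin m → ℝ, u ≠ 0 → variation u ≤ (k : ℤ) → variation (X.mulVec u) ≤ (k : ℤ)

/-- `X` is `k`-variation diminishing. -/
def VD {n m : ℕ} (X : Matrix (Fin n) (Fin m) ℝ) (k : ℕ) : Prop :=
  ∀ j : ℕ, j ≤ k → VB X j

/-- `X` is strictly `k`-sign consistent: all `k×k` minors strictly positive, or all strictly
negative. -/
def SSC {n m : ℕ} (X : Matrix (Fin n) (Fin m) ℝ) (k : ℕ) : Prop :=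
  (∀ (f : Fin k → Fin n) (g : Fin k → Fin m), StrictMono f → StrictMono g →
    0 < (X.submatrix f g).det) ∨
  (∀ (f : Fin k → Fin n) (g : Fin k → Fin m), StrictMono f → StrictMono g →
    (X.submatrix f g).det < 0)

/-- `X` is `k`-sign consistent: all `k×k` minors nonnegative, or all nonpositive. -/
def SC {n m : ℕ} (X : Matrix (Fin n) (Fin m) ℝ) (k : ℕ) : Prop :=
  (∀ (f : Fin k → Fin n) (g : Fin k → Fin m), StrictMono f → StrictMono g →
    0 ≤ (X.submatrix f g).det) ∨
  (∀ (f : Fin k → Fin n) (g : Fin k → Fin m), StrictMono f → StrictMono g →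
    (X.submatrix f g).det ≤ 0)

/-- `X` is `k`-sign regular. -/
def SR {n m : ℕ} (X : Matrix (Fin n) (Fin m) ℝ) (k : ℕ) : Prop :=
  ∀ j : ℕ, 1 ≤ j → j ≤ k → SC X j

/-- `X` is strictly totally positive. -/
def STP {n m : ℕ} (X : Matrix (Fin n) (Fin m) ℝ) : Prop :=
  ∀ (j : ℕ) (f : Fin j → Fin n) (g : Fin j → Fin m), StrictMono f → StrictMono g →
    0 < (X.submatrix f g).det

/-- `X` is `k`-positive: all `j×j` minors nonnegative for `j = 1, …, k`. -/
def KPos {n m : ℕ} (X : Matrix (Fin n) (Fin m) ℝ) (k : ℕ) : Prop :=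
  ∀ j : ℕ, 1 ≤ j → j ≤ k → ∀ (f : Fin j → Fin n) (g : Fin j → Fin m),
    StrictMono f → StrictMono g → 0 ≤ (X.submatrix f g).det

/-- `X` is strictly `k`-positive: all `j×j` minors positive for `j = 1, …, k`. -/
def KPosStrict {n m : ℕ} (X : Matrix (Fin n) (Fin m) ℝ) (k : ℕ) : Prop :=
  ∀ j : ℕ, 1 ≤ j → j ≤ k → ∀ (f : Fin j → Fin n) (g : Fin j → Fin m),
    StrictMono f → StrictMono g → 0 < (X.submatrix f g).det

/-- The `t`-step observability matrix `O_t` with `i`-th row `c Aⁱ⁻¹`. -/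
noncomputable def obsMat {n : ℕ} (A : Matrix (Fin n) (Fin n) ℝ) (c : Fin n → ℝ) (t : ℕ) :
    Matrix (Fin t) (Fin n) ℝ :=
  Matrix.of fun i j => Matrix.vecMul c (A ^ (i : ℕ)) j

/-- The pair `(A, c)` is observable. -/
def Observable {n : ℕ} (A : Matrix (Fin n) (Fin n) ℝ) (c : Fin n → ℝ) : Prop :=
  (obsMat A c n).det ≠ 0

/-- The observability operator of `(A, c)` is strictly `k`-variation bounding. -/
def ObsSVB {n : ℕ} (A : Matrix (Fin n) (Fin n) ℝ) (c : Fin n → ℝ) (k : ℕ) : Prop :=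
  ∀ t : ℕ, 0 < t → SVB (obsMat A c t) k

/-- The observability operator of `(A, c)` is `k`-variation bounding. -/
def ObsVB {n : ℕ} (A : Matrix (Fin n) (Fin n) ℝ) (c : Fin n → ℝ) (k : ℕ) : Prop :=
  ∀ t : ℕ, 0 < t → VB (obsMat A c t) k

/-- The matrix `M_r[t]`: first `n - r` rows `c, cA, …, cA^{n-r-1}`, last `r` rows
`cA^{n-r+t-1}, …, cA^{n+t-2}`. -/
noncomputable def Mrt {n : ℕ} (A : Matrix (Fin n) (Fin n) ℝ) (c : Fin n → ℝ) (r t : ℕ) :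
    Matrix (Fin n) (Fin n) ℝ :=
  Matrix.of fun i j =>
    Matrix.vecMul c (A ^ (if (i : ℕ) < n - r then (i : ℕ) else (i : ℕ) + t - 1)) j

theorem signChanges_cons_cons (x z : ℝ) (l : List ℝ) :
    signChanges (x :: z :: l) = signChanges (z :: l) + if x * z < 0 then 1 else 0 := by
  simp [signChanges, List.countP_cons]

/-- Every list of reals splits into consecutive blocks of constant weak sign, with one more
block than there are sign changes, each block containing a nonzero entry. -/
theorem exists_sign_blocks (l : List ℝ) :
    ∃ (s : ℕ → ℕ) (ε : ℝ), (ε = 1 ∨ ε = -1) ∧ s 0 = 0 ∧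
      (∀ j, s j ≤ s (j + 1) ∧ s (j + 1) ≤ s j + 1) ∧
      (∀ j, s j ≤ signChanges (l.filter fun x => decide (x ≠ 0))) ∧
      (∀ x ∈ (l.filter fun x => decide (x ≠ 0)).head?, 0 < ε * x) ∧
      (∀ j (h : j < l.length), 0 ≤ ε * (-1) ^ s j * l[j]) ∧
      ((l.filter fun x => decide (x ≠ 0)) ≠ [] →
        ∀ b ≤ signChanges (l.filter fun x => decide (x ≠ 0)),
          ∃ (j : ℕ) (h : j < l.length), s j = b ∧ l[j] ≠ 0) := by
  induction l with
  | nil => exact ⟨fun _ => 0, 1, by simp⟩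
  | cons y l ih =>
    obtain ⟨s, ε, hε, h0, hstep, hle, hhead, hsign, hex⟩ := ih
    by_cases hy : y = 0
    · subst hy
      have hf : ((0 : ℝ) :: l).filter (fun x => decide (x ≠ 0))
          = l.filter (fun x => decide (x ≠ 0)) := by simp
      rw [hf]
      refine ⟨fun j => s (j - 1), ε, hε, by simpa using h0, ?_, fun j => hle _, hhead, ?_, ?_⟩
      · rintro (_ | j)
        · simp
        · simpa using hstep j
      · rintro (_ | j) h
        · simp
        · simpa using hsign j (by simpa using h)
      · intro hne b hb
        obtain ⟨j, h, hj⟩ := hex hne b hb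
        exact ⟨j + 1, by simpa using h, by simpa using hj⟩
    · have hf : (y :: l).filter (fun x => decide (x ≠ 0))
          = y :: l.filter (fun x => decide (x ≠ 0)) := by simp [hy]
      rw [hf]
      generalize hL : l.filter (fun x => decide (x ≠ 0)) = L at *
      cases L with
      | nil =>
        have hz : ∀ j (h : j < l.length), l[j] = 0 := by
          intro j h
          by_contra hc
          have : l[j] ∈ l.filter (fun x => decide (x ≠ 0)) := by
            simp [List.mem_filter, hc]
          rw [hL] at this
          simp at this
        refine ⟨fun _ => 0, if 0 < y then 1 else -1, by split_ifs <;> simp, rfl, by simp,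
          by simp, ?_, ?_, ?_⟩
        · rcases lt_or_gt_of_ne hy with h | h
          · simp [h.not_gt, h]
          · simp [h]
        · rintro (_ | j) h
          · rcases lt_or_gt_of_ne hy with h | h
            · simp [h.not_gt, h.le]
            · simp [h, h.le]
          · simp [hz j (by simpa using h)]
        · intro _ b hb
          have : b = 0 := by simpa [signChanges] using hb
          exact ⟨0, by simp, by simp [this, hy]⟩
      | cons z L =>
        have hz : 0 < ε * z := hhead z (by simp)
        rw [signChanges_cons_cons]
        by_cases hyz : y * z < 0
        · have hy' : 0 < -ε * y := by
            rcases hε with rfl | rfl <;> nlinarith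
          rw [if_pos hyz]
          refine ⟨fun j => if j = 0 then 0 else s (j - 1) + 1, -ε, ?_, rfl, ?_, ?_, ?_, ?_, ?_⟩
          · rcases hε with rfl | rfl <;> simp
          · rintro (_ | j)
            · simp [h0]
            · simpa using hstep j
          · rintro (_ | j)
            · simp
            · simpa using hle j
          · simpa using hy'
          · rintro (_ | j) h
            · simpa using hy'.le
            · have := hsign j (by simpa using h)
              simp only [Nat.add_eq_zero_iff, one_ne_zero, and_false, if_false,
                Nat.add_sub_cancel, List.getElem_cons_succ, pow_succ]
              linarith
          · rintro - (_ | b) hb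
            · exact ⟨0, by simp, by simp [hy]⟩
            · obtain ⟨j, h, hj⟩ := hex (by simp) b (by omega)
              exact ⟨j + 1, by simpa using h, by simpa using hj⟩
        · have hy' : 0 < ε * y := by
            have : 0 ≤ y * z := not_lt.mp hyz
            have hz0 : z ≠ 0 := by rintro rfl; simp at hz
            have : 0 < y * z := lt_of_le_of_ne this (by positivity)
            rcases hε with rfl | rfl <;> nlinarith
          rw [if_neg hyz]
          refine ⟨fun j => s (j - 1), ε, hε, by simpa using h0, ?_, fun j => hle _, ?_, ?_, ?_⟩
          · rintro (_ | j)
            · simp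
            · simpa using hstep j
          · simpa using hy'
          · rintro (_ | j) h
            · simpa [h0] using hy'.le
            · simpa using hsign j (by simpa using h)
          · intro _ b hb
            obtain ⟨j, h, hj⟩ := hex (by simp) b (by simpa using hb)
            exact ⟨j + 1, by simpa using h, by simpa using hj⟩

/-- A vector of variation less than `k` has at most `k` consecutive blocks of constant sign. -/
theorem exists_sign_blocks_of_variation_lt {m k : ℕ} (hk : 1 ≤ k) {u : Fin m → ℝ}
    (hu : variation u < k) :
    ∃ (s : ℕ → ℕ) (ε : ℝ), (ε = 1 ∨ ε = -1) ∧ s 0 = 0 ∧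
      (∀ j, s j ≤ s (j + 1) ∧ s (j + 1) ≤ s j + 1) ∧ (∀ j, s j < k) ∧
      ∀ j : Fin m, 0 ≤ ε * (-1) ^ s j * u j := by
  obtain ⟨s, ε, hε, h0, hstep, hle, -, hsign, -⟩ := exists_sign_blocks (List.ofFn u)
  refine ⟨s, ε, hε, h0, hstep, fun j => (hle j).trans_lt ?_, fun j => ?_⟩
  · unfold variation at hu
    split_ifs at hu with h
    · rw [h]; simpa [signChanges] using Nat.pos_of_ne_zero (by omega)
    · exact_mod_cast hu
  · simpa using hsign j (by simp)

/-- A vector `y` alternates along `T` if its entries at `T 0, T 1, …` have strictly alternating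
signs. -/
def AlternatesAlong {n k : ℕ} (y : Fin n → ℝ) (T : Fin k → Fin n) : Prop :=
  StrictMono T ∧ ∃ ε : ℝ, ∀ b : Fin k, 0 < ε * (-1) ^ (b : ℕ) * y (T b)

theorem exists_alternatesAlong_of_le_variation {n k : ℕ} {y : Fin n → ℝ}
    (hy : (k : ℤ) ≤ variation y) : ∃ T : Fin (k + 1) → Fin n, AlternatesAlong y T := by
  obtain ⟨s, ε, hε, h0, hstep, hle, -, hsign, hex⟩ := exists_sign_blocks (List.ofFn y)
  have hmono : Monotone s := monotone_nat_of_le_succ fun j => (hstep j).1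
  unfold variation at hy
  split_ifs at hy with h
  · omega
  have hy' : k ≤ signChanges ((List.ofFn y).filter fun x => decide (x ≠ 0)) := by
    exact_mod_cast hy
  choose j hj hs hne using fun b : Fin (k + 1) => hex h b (by omega)
  refine ⟨fun b => ⟨j b, by simpa using hj b⟩, fun b c hbc => ?_, ε, fun b => ?_⟩
  · by_contra hc
    have := hmono (not_lt.mp hc : j c ≤ j b)
    rw [hs, hs] at this
    omega
  · have h1 := hsign (j b) (hj b)
    have h2 := hne b
    rw [hs] at h1
    simp only [List.getElem_ofFn] at h1 h2
    refine lt_of_le_of_ne h1 (Ne.symm ?_)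
    have : ε ≠ 0 := by rcases hε with rfl | rfl <;> norm_num
    simp [this, h2]

theorem AlternatesAlong.mul_neg {n k : ℕ} {y : Fin n → ℝ} {T : Fin (k + 1) → Fin n}
    (h : AlternatesAlong y T) (b : Fin k) : y (T b.castSucc) * y (T b.succ) < 0 := by
  obtain ⟨-, ε, hε⟩ := h
  have h1 := hε b.castSucc
  have h2 := hε b.succ
  simp only [Fin.val_castSucc, Fin.val_succ, pow_succ] at h1 h2
  have := mul_pos h1 h2
  have h3 : 0 < (ε * (-1) ^ (b : ℕ)) ^ 2 * (-(y (T b.castSucc) * y (T b.succ))) := by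
    linarith
  have := pos_of_mul_pos_right h3 (sq_nonneg _)
  linarith

/-- A vector with `k` consecutive blocks of constant sign has variation less than `k`. -/
theorem variation_lt_of_blocks {m k : ℕ} {u w : Fin m → ℝ} {c : Fin k → ℝ} {φ : Fin m → Fin k}
    (hφ : Monotone φ) (hw : ∀ j, 0 ≤ w j) (hu : ∀ j, u j = w j * c (φ j)) :
    variation u < k := by
  by_contra hc
  obtain ⟨T, hT⟩ := exists_alternatesAlong_of_le_variation (not_lt.mp hc)
  have hmono : StrictMono (φ ∘ T) := by
    rw [Fin.strictMono_iff_lt_succ]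
    intro b
    refine lt_of_le_of_ne (hφ (hT.1.monotone (Fin.castSucc_lt_succ).le)) fun heq => ?_
    have h := hT.mul_neg b
    rw [hu, hu] at h
    simp only [Function.comp_apply] at heq
    rw [heq] at h
    have := mul_nonneg (mul_nonneg (hw (T b.castSucc)) (hw (T b.succ)))
      (mul_self_nonneg (c (φ (T b.succ))))
    linarith
  simpa using Fintype.card_le_of_injective _ hmono.injective

/-- Moving one entry of a strictly monotone map to an adjacent free value preserves strict
monotonicity. -/
theorem StrictMono.update_of_adjacent {n k : ℕ} {f : Fin k → Fin n} (hf : StrictMono f)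
    {a : Fin k} {v : Fin n} (hv : (v : ℕ) = f a + 1 ∨ (f a : ℕ) = v + 1) (hr : ∀ b, f b ≠ v) :
    StrictMono (Function.update f a v) := by
  intro b c hbc
  have h := hf hbc
  have hb := Fin.val_ne_of_ne (hr b)
  have hc := Fin.val_ne_of_ne (hr c)
  simp only [Function.update_apply, Fin.lt_def] at *
  split_ifs with h1 h2 h2
  · omega
  · subst h1; omega
  · subst h2; omega
  · exact h

/-- The `ℓ¹` distance between two index maps. -/
def indexDist {n k : ℕ} (f h : Fin k → Fin n) : ℕ :=
  ∑ b, (((f b : ℕ) - h b) + ((h b : ℕ) - f b))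

theorem indexDist_update_lt {n k : ℕ} {f h : Fin k → Fin n} {a : Fin k} {v : Fin n}
    (hv : ((v : ℕ) = f a + 1 ∧ f a < h a) ∨ ((f a : ℕ) = v + 1 ∧ h a < f a)) :
    indexDist (Function.update f a v) h < indexDist f h := by
  refine Finset.sum_lt_sum (fun b _ => ?_) ⟨a, Finset.mem_univ _, ?_⟩
  · by_cases hb : b = a
    · subst hb
      simp only [Function.update_self, Fin.lt_def] at *
      omega
    · simp [Function.update_of_ne hb]
  · simp only [Function.update_self, Fin.lt_def] at *
    omega

/-- Two distinct strictly monotone maps can be brought closer by moving an entry of the first one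
to an adjacent free value. -/
theorem exists_adjacent_indexDist_lt {n k : ℕ} {f h : Fin k → Fin n} (hf : StrictMono f)
    (hh : StrictMono h) (hne : f ≠ h) :
    ∃ (a : Fin k) (v : Fin n), ((v : ℕ) = f a + 1 ∨ (f a : ℕ) = v + 1) ∧ (∀ b, f b ≠ v) ∧
      indexDist (Function.update f a v) h < indexDist f h := by
  by_cases hlt : ∃ a, f a < h a
  · obtain ⟨a, ha, hmax⟩ := Finset.exists_max_image (Finset.univ.filter fun a => f a < h a) id
      (by obtain ⟨a, ha⟩ := hlt; exact ⟨a, by simpa using ha⟩)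
    simp only [Finset.mem_filter, Finset.mem_univ, true_and, id] at ha hmax
    have ha' : (f a : ℕ) < h a := ha
    refine ⟨a, ⟨f a + 1, by omega⟩, Or.inl rfl, fun b hb => ?_,
      indexDist_update_lt (Or.inl ⟨rfl, ha⟩)⟩
    have hb' : (f b : ℕ) = f a + 1 := congrArg Fin.val hb
    have hab : a < b := hf.lt_iff_lt.mp (Fin.lt_def.mpr (by omega))
    have h1 : (h a : ℕ) < h b := hh hab
    exact absurd (hmax b (Fin.lt_def.mpr (by omega))) (not_le.mpr hab)
  · have hgt : ∃ a, h a < f a := by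
      by_contra hc
      push Not at hlt hc
      exact hne (funext fun a => le_antisymm (hc a) (hlt a))
    obtain ⟨a, ha, hmin⟩ := Finset.exists_min_image (Finset.univ.filter fun a => h a < f a) id
      (by obtain ⟨a, ha⟩ := hgt; exact ⟨a, by simpa using ha⟩)
    simp only [Finset.mem_filter, Finset.mem_univ, true_and, id] at ha hmin
    have ha' : (h a : ℕ) < f a := ha
    have hv : (f a : ℕ) = (f a - 1) + 1 := by omega
    refine ⟨a, ⟨f a - 1, by omega⟩, Or.inr hv, fun b hb => ?_,
      indexDist_update_lt (Or.inr ⟨hv, ha⟩)⟩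
    have hb' : (f b : ℕ) = f a - 1 := congrArg Fin.val hb
    have hab : b < a := hf.lt_iff_lt.mp (Fin.lt_def.mpr (by omega))
    have h1 : (h b : ℕ) < h a := hh hab
    exact absurd (hmin b (Fin.lt_def.mpr (by omega))) (not_le.mpr hab)

/-- Add `t` times row `p` to row `v`. -/
def addRow {n k : ℕ} (Z : Matrix (Fin n) (Fin k) ℝ) (p v : Fin n) (t : ℝ) :
    Matrix (Fin n) (Fin k) ℝ :=
  Z.updateRow v (Z v + t • Z p)

theorem addRow_mulVec {n k : ℕ} (Z : Matrix (Fin n) (Fin k) ℝ) (p v : Fin n) (t : ℝ)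
    (c : Fin k → ℝ) :
    (addRow Z p v t).mulVec c
      = Function.update (Z.mulVec c) v (Z.mulVec c v + t * Z.mulVec c p) := by
  ext i
  by_cases hi : i = v
  · subst hi
    simp only [addRow, Matrix.mulVec, Matrix.updateRow_self, Function.update_self]
    rw [add_dotProduct, smul_dotProduct, smul_eq_mul]
  · simp [addRow, Matrix.mulVec, hi]

theorem det_addRow_submatrix_of_forall_ne {n k : ℕ} (Z : Matrix (Fin n) (Fin k) ℝ) (p v : Fin n)
    (t : ℝ) {f : Fin k → Fin n} (hf : ∀ b, f b ≠ v) :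
    ((addRow Z p v t).submatrix f id).det = (Z.submatrix f id).det := by
  congr 1
  ext i j
  simp [addRow, hf i]

theorem det_addRow_submatrix {n k : ℕ} (Z : Matrix (Fin n) (Fin k) ℝ) (p : Fin n)
    (t : ℝ) {f : Fin k → Fin n} (hf : Function.Injective f) (b : Fin k) :
    ((addRow Z p (f b) t).submatrix f id).det
      = (Z.submatrix f id).det + t * (Z.submatrix (Function.update f b p) id).det := by
  have h1 : (addRow Z p (f b) t).submatrix f id
      = (Z.submatrix f id).updateRow b ((Z.submatrix f id) b + t • Z p) := by
    ext i j
    by_cases hi : i = b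
    · subst hi; simp [addRow]
    · simp [addRow, hi, hf.ne hi]
  have h2 : (Z.submatrix f id).updateRow b (Z p) = Z.submatrix (Function.update f b p) id := by
    ext i j
    by_cases hi : i = b
    · subst hi; simp
    · simp [hi]
  rw [h1, Matrix.det_updateRow_add, Matrix.updateRow_eq_self, Matrix.det_updateRow_smul, h2]

theorem minors_addRow_nonneg {n k : ℕ} {Z : Matrix (Fin n) (Fin k) ℝ} {τ t : ℝ} {p v : Fin n}
    (hZ : ∀ f, StrictMono f → 0 ≤ τ * (Z.submatrix f id).det)
    (hpv : (p : ℕ) = v + 1 ∨ (v : ℕ) = p + 1) (ht : 0 ≤ t) {f : Fin k → Fin n}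
    (hf : StrictMono f) : 0 ≤ τ * ((addRow Z p v t).submatrix f id).det := by
  by_cases hv : ∃ b, f b = v
  · obtain ⟨b, rfl⟩ := hv
    rw [det_addRow_submatrix _ _ _ hf.injective, mul_add, mul_left_comm]
    refine add_nonneg (hZ f hf) (mul_nonneg ht ?_)
    by_cases hp : ∃ b', f b' = p
    · obtain ⟨b', rfl⟩ := hp
      have hne : b' ≠ b := by rintro rfl; omega
      rw [Matrix.det_zero_of_row_eq hne, mul_zero]
      ext j
      simp [hne]
    · exact hZ _ (hf.update_of_adjacent hpv (not_exists.mp hp))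
  · rw [det_addRow_submatrix_of_forall_ne _ _ _ _ (not_exists.mp hv)]
    exact hZ f hf

theorem AlternatesAlong.eventually {n k : ℕ} {y : ℝ → Fin n → ℝ} {T : Fin k → Fin n} {t₀ : ℝ}
    (hy : ∀ i, ContinuousAt (fun t => y t i) t₀) (h : AlternatesAlong (y t₀) T) :
    ∀ᶠ t in nhds t₀, AlternatesAlong (y t) T := by
  obtain ⟨hT, ε, hε⟩ := h
  have : ∀ᶠ t in nhds t₀, ∀ b : Fin k, 0 < ε * (-1) ^ (b : ℕ) * y t (T b) :=
    Filter.eventually_all.mpr fun b =>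
      ContinuousAt.eventually_lt continuousAt_const (continuousAt_const.mul (hy (T b))) (hε b)
  exact this.mono fun t ht => ⟨hT, ε, ht⟩

theorem AlternatesAlong.eventually_addRow {n k l : ℕ} {Z : Matrix (Fin n) (Fin k) ℝ}
    {c : Fin k → ℝ} {T : Fin l → Fin n} (h : AlternatesAlong (Z.mulVec c) T) (p v : Fin n) :
    ∀ᶠ t in nhds (0 : ℝ), AlternatesAlong ((addRow Z p v t).mulVec c) T := by
  refine AlternatesAlong.eventually (fun i => ?_) (by simpa [addRow] using h)
  simp only [addRow_mulVec, Function.update_apply]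
  split_ifs <;> fun_prop

theorem not_alternatesAlong_of_minor_castSucc_pos {n k : ℕ} {Z : Matrix (Fin n) (Fin k) ℝ}
    {τ : ℝ} (hZ : ∀ f, StrictMono f → 0 ≤ τ * (Z.submatrix f id).det)
    {T : Fin (k + 1) → Fin n} (hpos : 0 < τ * (Z.submatrix (T ∘ Fin.castSucc) id).det)
    (c : Fin k → ℝ) : ¬ AlternatesAlong (Z.mulVec c) T := by
  rintro ⟨hT, ε, hε⟩
  let M : Matrix (Fin (k + 1)) (Fin (k + 1)) ℝ :=
    Matrix.of fun i => Fin.cons (Z.mulVec c (T i)) (Z (T i))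
  have hdet : M.det = 0 := by
    rw [← Matrix.exists_mulVec_eq_zero_iff]
    refine ⟨Fin.cons (-1) c, fun h => by simpa using congrFun h 0, ?_⟩
    ext i
    simp [M, Matrix.mulVec, dotProduct, Fin.sum_univ_succ]
  rw [Matrix.det_succ_column_zero] at hdet
  have hsub : ∀ i : Fin (k + 1), M.submatrix i.succAbove Fin.succ
      = Z.submatrix (T ∘ i.succAbove) id := by
    intro i
    ext a b
    simp [M]
  have hsum : 0 < ∑ i : Fin (k + 1), (ε * (-1) ^ (i : ℕ) * Z.mulVec c (T i)) *
      (τ * (Z.submatrix (T ∘ i.succAbove) id).det) := by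
    refine Finset.sum_pos' (fun i _ => mul_nonneg (hε i).le
      (hZ _ (hT.comp (Fin.strictMono_succAbove i)))) ⟨Fin.last k, Finset.mem_univ _,
      mul_pos (hε _) ?_⟩
    rwa [Fin.succAbove_last]
  have : ∑ i : Fin (k + 1), (ε * (-1) ^ (i : ℕ) * Z.mulVec c (T i)) *
      (τ * (Z.submatrix (T ∘ i.succAbove) id).det)
      = ε * τ * ∑ i : Fin (k + 1), (-1) ^ (i : ℕ) * M i 0 *
        (M.submatrix i.succAbove Fin.succ).det := by
    rw [Finset.mul_sum]
    refine Finset.sum_congr rfl fun i _ => ?_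
    rw [hsub]
    simp only [M, Matrix.of_apply, Fin.cons_zero]
    ring
  rw [this, hdet, mul_zero] at hsum
  exact hsum.false

theorem Filter.Eventually.exists_pos {P : ℝ → Prop} (h : ∀ᶠ t in nhds (0 : ℝ), P t) :
    ∃ t, 0 < t ∧ P t :=
  ((h.filter_mono nhdsWithin_le_nhds).and
    (self_mem_nhdsWithin : Set.Ioi (0 : ℝ) ∈ nhdsWithin 0 (Set.Ioi 0))).exists.imp
    fun _ ht => ⟨ht.2, ht.1⟩

/-- If the maximal minors of `Z` are weakly of one sign and do not all vanish, then vectors in the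
column space of `Z` do not alternate along more indices than `Z` has columns. -/
theorem not_alternatesAlong_of_minors_nonneg {n k : ℕ} {Z : Matrix (Fin n) (Fin k) ℝ} {τ : ℝ}
    (hZ : ∀ f, StrictMono f → 0 ≤ τ * (Z.submatrix f id).det) {f : Fin k → Fin n}
    (hf : StrictMono f) (hpos : 0 < τ * (Z.submatrix f id).det) (c : Fin k → ℝ)
    (T : Fin (k + 1) → Fin n) : ¬ AlternatesAlong (Z.mulVec c) T := by
  intro hT
  induction hN : indexDist f (T ∘ Fin.castSucc) using Nat.strong_induction_on
    generalizing Z f with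
  | _ N ih =>
  by_cases hfT : f = T ∘ Fin.castSucc
  · subst hfT
    exact not_alternatesAlong_of_minor_castSucc_pos hZ hpos c hT
  · obtain ⟨a, v, hav, hv, hlt⟩ :=
      exists_adjacent_indexDist_lt hf (hT.1.comp Fin.strictMono_castSucc) hfT
    obtain ⟨t, ht, htT⟩ := (hT.eventually_addRow (f a) v).exists_pos
    have hf' := hf.update_of_adjacent hav hv
    refine ih _ (hN ▸ hlt) (fun g hg => minors_addRow_nonneg hZ (by omega) ht.le hg) hf' ?_ htT rfl
    have h := det_addRow_submatrix Z (f a) t hf'.injective a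
    rw [Function.update_self, Function.update_idem, Function.update_eq_self] at h
    rw [h, mul_add, mul_left_comm]
    exact add_pos_of_nonneg_of_pos (hZ _ hf') (mul_pos ht hpos)

theorem AlternatesAlong.of_update_add {n k : ℕ} {y : Fin n → ℝ} {p v : Fin n} {t : ℝ}
    {T : Fin k → Fin n} (hpv : (p : ℕ) = v + 1 ∨ (v : ℕ) = p + 1) (ht : 0 < t)
    (h : AlternatesAlong (Function.update y v (y v + t * y p)) T) :
    ∃ T' : Fin k → Fin n, AlternatesAlong y T' := by
  obtain ⟨hT, ε, hε⟩ := h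
  have hof : ∀ b, T b ≠ v → 0 < ε * (-1) ^ (b : ℕ) * y (T b) := fun b hb => by
    simpa [hb] using hε b
  by_cases hv : ∃ b, T b = v
  · obtain ⟨b, rfl⟩ := hv
    have hne : ∀ c, c ≠ b → 0 < ε * (-1) ^ (c : ℕ) * y (T c) := fun c hc =>
      hof c (hT.injective.ne hc)
    by_cases hb : 0 < ε * (-1) ^ (b : ℕ) * y (T b)
    · refine ⟨T, hT, ε, fun c => ?_⟩
      by_cases hc : c = b
      · exact hc ▸ hb
      · exact hne c hc
    · have h1 := hε b
      rw [Function.update_self] at h1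
      have h2 : 0 < ε * (-1) ^ (b : ℕ) * y p :=
        pos_of_mul_pos_right (by linarith : 0 < t * (ε * (-1) ^ (b : ℕ) * y p)) ht.le
      refine ⟨Function.update T b p, hT.update_of_adjacent hpv ?_, ε, fun c => ?_⟩
      · rintro b' rfl
        have hb' : b' ≠ b := by rintro rfl; omega
        have h3 := hne b' hb'
        have hadj : (b' : ℕ) = b + 1 ∨ (b : ℕ) = b' + 1 := by
          by_contra hc
          rcases lt_or_gt_of_ne (Fin.val_ne_of_ne hb') with hlt | hlt
          · have e1 : (T b' : ℕ) < T ⟨b' + 1, by omega⟩ := hT (Fin.lt_def.mpr (by simp))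
            have e2 : (T ⟨b' + 1, by omega⟩ : ℕ) < T b :=
              hT (Fin.lt_def.mpr (by simp only; omega))
            omega
          · have e1 : (T b : ℕ) < T ⟨b + 1, by omega⟩ := hT (Fin.lt_def.mpr (by simp))
            have e2 : (T ⟨b + 1, by omega⟩ : ℕ) < T b' :=
              hT (Fin.lt_def.mpr (by simp only; omega))
            omega
        rcases hadj with h | h
        · rw [h, pow_succ] at h3; linarith
        · rw [h, pow_succ] at h2; linarith
      · by_cases hc : c = b
        · subst hc; simpa using h2
        · simpa [hc] using hne c hc
  · exact ⟨T, hT, ε, fun b => hof b (not_exists.mp hv b)⟩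

/-- If no vector in the column space of `Z` alternates along `k + 1` indices, then two maximal
minors whose row sets differ by an adjacent move upwards have weakly the same sign. -/
theorem minor_mul_minor_update_nonneg_of_eq_add_one {n k : ℕ} {Z : Matrix (Fin n) (Fin k) ℝ}
    (H : ∀ (c : Fin k → ℝ) (T : Fin (k + 1) → Fin n), ¬ AlternatesAlong (Z.mulVec c) T)
    {f : Fin k → Fin n} (hf : StrictMono f) {a : Fin k} {v : Fin n} (hv : (v : ℕ) = f a + 1)
    (hr : ∀ b, f b ≠ v) :
    0 ≤ (Z.submatrix f id).det * (Z.submatrix (Function.update f a v) id).det := by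
  by_contra! hneg
  set A := Z.submatrix f id with hA
  have hdet : A.det ≠ 0 := by intro h; simp [h] at hneg
  have hunit : IsUnit A.det := isUnit_iff_ne_zero.mpr hdet
  set α := Matrix.vecMul (Z v) A⁻¹ with hα
  have hvα : Z v = Matrix.vecMul α A := by
    rw [hα, Matrix.vecMul_vecMul, Matrix.nonsing_inv_mul _ hunit, Matrix.vecMul_one]
  have hup : Z.submatrix (Function.update f a v) id = A.updateRow a (∑ b, α b • A b) := by
    rw [← Matrix.vecMul_eq_sum, ← hvα]
    ext i j
    by_cases hi : i = a
    · subst hi; simp only [Matrix.submatrix_apply, Function.update_self, Matrix.updateRow_self, id]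
    · simp [hi, hA]
  rw [hup, Matrix.det_updateRow_sum, smul_eq_mul] at hneg
  have hαa : α a < 0 := by nlinarith [mul_self_pos.mpr hdet]
  set K := ∑ b ∈ Finset.univ.erase a, α b * (-1) ^ (a.succ.succAbove b : ℕ) with hK
  set M := (|K| + 1) / (-α a) with hM
  have hMpos : 0 < M := div_pos (by positivity) (by linarith)
  have hMα : -α a * M = |K| + 1 := mul_div_cancel₀ _ (by linarith)
  set η : Fin k → ℝ := fun b => (-1) ^ (a.succ.succAbove b : ℕ) * (if b = a then M else 1) with hη
  have hrow : A.mulVec (A⁻¹.mulVec η) = η := by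
    rw [Matrix.mulVec_mulVec, Matrix.mul_nonsing_inv _ hunit, Matrix.one_mulVec]
  refine H (A⁻¹.mulVec η) (Fin.insertNth a.succ v f) ⟨fun i j hij => ?_, 1, fun i => ?_⟩
  · rcases Fin.eq_self_or_eq_succAbove a.succ i with rfl | ⟨b, rfl⟩ <;>
      rcases Fin.eq_self_or_eq_succAbove a.succ j with rfl | ⟨c, rfl⟩
    · exact absurd hij (lt_irrefl _)
    · rw [Fin.insertNth_apply_same, Fin.insertNth_apply_succAbove]
      have h1 : a < c := by
        rw [Fin.lt_succAbove_iff_le_castSucc] at hij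
        simp only [Fin.le_def, Fin.val_castSucc, Fin.val_succ, Fin.lt_def] at hij ⊢
        omega
      have h2 : (f a : ℕ) < f c := hf h1
      have h3 := Fin.val_ne_of_ne (hr c)
      exact Fin.lt_def.mpr (by omega)
    · rw [Fin.insertNth_apply_same, Fin.insertNth_apply_succAbove]
      have h1 : b ≤ a := by
        rw [Fin.succAbove_lt_iff_castSucc_lt] at hij
        simp only [Fin.lt_def, Fin.val_castSucc, Fin.val_succ, Fin.le_def] at hij ⊢
        omega
      have h2 : (f b : ℕ) ≤ f a := hf.monotone h1
      exact Fin.lt_def.mpr (by omega)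
    · rw [Fin.insertNth_apply_succAbove, Fin.insertNth_apply_succAbove]
      exact hf ((Fin.strictMono_succAbove _).lt_iff_lt.mp hij)
  · rcases Fin.eq_self_or_eq_succAbove a.succ i with rfl | ⟨b, rfl⟩
    · rw [Fin.insertNth_apply_same]
      have h1 : Z.mulVec (A⁻¹.mulVec η) v = ∑ b, α b * η b := by
        change Z v ⬝ᵥ A⁻¹.mulVec η = α ⬝ᵥ η
        rw [hvα, ← Matrix.dotProduct_mulVec, hrow]
      have h2 : ∑ b, α b * η b = α a * ((-1) ^ (a : ℕ) * M) + K := by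
        rw [← Finset.add_sum_erase _ _ (Finset.mem_univ a)]
        congr 1
        · simp [hη]
        · refine Finset.sum_congr rfl fun b hb => ?_
          simp [hη, Finset.ne_of_mem_erase hb]
      rw [h1, h2, Fin.val_succ, pow_succ]
      have h3 : 1 * ((-1) ^ (a : ℕ) * -1) * (α a * ((-1) ^ (a : ℕ) * M) + K)
          = ((-1) ^ (a : ℕ)) ^ 2 * (-α a * M) - (-1) ^ (a : ℕ) * K := by ring
      have h4 : (-1 : ℝ) ^ (a : ℕ) * K ≤ |K| := by
        refine (le_abs_self _).trans ?_
        rw [abs_mul, abs_pow, abs_neg, abs_one, one_pow, one_mul]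
      rw [h3, hMα, ← pow_mul, mul_comm (a : ℕ), pow_mul, neg_one_sq, one_pow]
      linarith
    · rw [Fin.insertNth_apply_succAbove]
      have h1 : Z.mulVec (A⁻¹.mulVec η) (f b) = η b := congrFun hrow b
      rw [h1, one_mul, hη]
      simp only
      rw [← mul_assoc, ← pow_add, ← two_mul, pow_mul, neg_one_sq, one_pow, one_mul]
      split_ifs
      · exact hMpos
      · exact one_pos

theorem minor_mul_minor_update_nonneg {n k : ℕ} {Z : Matrix (Fin n) (Fin k) ℝ}
    (H : ∀ (c : Fin k → ℝ) (T : Fin (k + 1) → Fin n), ¬ AlternatesAlong (Z.mulVec c) T)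
    {f : Fin k → Fin n} (hf : StrictMono f) {a : Fin k} {v : Fin n}
    (hv : (v : ℕ) = f a + 1 ∨ (f a : ℕ) = v + 1) (hr : ∀ b, f b ≠ v) :
    0 ≤ (Z.submatrix f id).det * (Z.submatrix (Function.update f a v) id).det := by
  rcases hv with hv | hv
  · exact minor_mul_minor_update_nonneg_of_eq_add_one H hf hv hr
  · have hf' := hf.update_of_adjacent (Or.inr hv) hr
    have h := minor_mul_minor_update_nonneg_of_eq_add_one H hf' (a := a) (v := f a)
      (by simpa using hv) (fun b => by
        by_cases hb : b = a
        · subst hb; simpa using (hr b).symm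
        · simpa [hb] using hf.injective.ne hb)
    rw [Function.update_idem, Function.update_eq_self] at h
    rwa [mul_comm]

/-- If no vector in the column space of `Z` alternates along more indices than `Z` has columns,
then the maximal minors of `Z` are weakly of one sign. -/
theorem minor_nonneg_of_not_alternatesAlong {n k : ℕ} {Z : Matrix (Fin n) (Fin k) ℝ} {τ : ℝ}
    (H : ∀ (c : Fin k → ℝ) (T : Fin (k + 1) → Fin n), ¬ AlternatesAlong (Z.mulVec c) T)
    {f h : Fin k → Fin n} (hf : StrictMono f) (hh : StrictMono h)
    (hpos : 0 < τ * (Z.submatrix f id).det) : 0 ≤ τ * (Z.submatrix h id).det := by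
  by_contra! hneg
  induction hN : indexDist f h using Nat.strong_induction_on generalizing Z f with
  | _ N ih =>
  by_cases hfh : f = h
  · subst hfh; linarith
  · obtain ⟨a, v, hav, hv, hlt⟩ := exists_adjacent_indexDist_lt hf hh hfh
    have hf' := hf.update_of_adjacent hav hv
    have hev : ∀ᶠ t in nhds (0 : ℝ), τ * ((addRow Z (f a) v t).submatrix h id).det < 0 := by
      by_cases hb : ∃ b, h b = v
      · obtain ⟨b, rfl⟩ := hb
        simp only [det_addRow_submatrix _ _ _ hh.injective]
        refine ContinuousAt.eventually_lt (by fun_prop) continuousAt_const ?_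
        simpa using hneg
      · simp only [det_addRow_submatrix_of_forall_ne _ _ _ _ (not_exists.mp hb)]
        exact Filter.Eventually.of_forall fun _ => hneg
    obtain ⟨t, ht, hth⟩ := hev.exists_pos
    refine ih _ (hN ▸ hlt) (Z := addRow Z (f a) v t) (fun c T hT => ?_) hf' ?_ hth rfl
    · rw [addRow_mulVec] at hT
      obtain ⟨T', hT'⟩ := hT.of_update_add (by omega) ht
      exact H c T' hT'
    · have h1 := det_addRow_submatrix Z (f a) t hf'.injective a
      rw [Function.update_self, Function.update_idem, Function.update_eq_self] at h1
      rw [h1, mul_add, mul_left_comm]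
      refine add_pos_of_nonneg_of_pos ?_ (mul_pos ht hpos)
      have h2 := minor_mul_minor_update_nonneg H hf hav hv
      refine nonneg_of_mul_nonneg_right ?_ hpos
      calc 0 ≤ τ ^ 2 * ((Z.submatrix f id).det *
            (Z.submatrix (Function.update f a v) id).det) := mul_nonneg (sq_nonneg _) h2
        _ = _ := by ring

/-- A matrix with injective action has a nonzero maximal minor. -/
theorem exists_minor_ne_zero {n k : ℕ} {Z : Matrix (Fin n) (Fin k) ℝ}
    (hZ : ∀ c, Z.mulVec c = 0 → c = 0) :
    ∃ f : Fin k → Fin n, StrictMono f ∧ (Z.submatrix f id).det ≠ 0 := by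
  obtain ⟨κ, r, hr, hspan, hli⟩ := exists_linearIndependent' ℝ Z.row
  have hinj : Function.Injective Z.mulVec := by
    intro c d hcd
    have := hZ (c - d) (by rw [Matrix.mulVec_sub]; exact sub_eq_zero.mpr hcd)
    exact sub_eq_zero.mp this
  have hrank : Z.rank = k := by
    have h := (Matrix.mulVec_injective_iff.mp hinj).rank_matrix (M := Zᵀ)
    rw [Matrix.rank_transpose] at h
    simpa using h
  have hfin : Finite κ := Finite.of_injective r hr
  have := Fintype.ofFinite κ
  have hcard : Fintype.card κ = k := by
    rw [linearIndependent_iff_card_eq_finrank_span.mp hli, Set.finrank, hspan,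
      ← Matrix.rank_eq_finrank_span_row, hrank]
  let s : Finset (Fin n) := Finset.univ.map ⟨r, hr⟩
  have hs : s.card = k := by simp [s, hcard]
  have hmem : ∀ i, ∃ x, r x = s.orderEmbOfFin hs i := fun i => by
    obtain ⟨x, -, hx⟩ := Finset.mem_map.mp (s.orderEmbOfFin_mem hs i)
    exact ⟨x, hx⟩
  choose b hb using hmem
  refine ⟨s.orderEmbOfFin hs, (s.orderEmbOfFin hs).strictMono, ?_⟩
  have hbinj : Function.Injective b := fun i j hij => by
    apply (s.orderEmbOfFin hs).injective
    rw [← hb, ← hb, hij]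
  have h := hli.comp b hbinj
  rw [← isUnit_iff_ne_zero, ← Matrix.isUnit_iff_isUnit_det,
    ← Matrix.linearIndependent_rows_iff_isUnit]
  have heq : (Z.submatrix (s.orderEmbOfFin hs) id).row = (Z.row ∘ r) ∘ b := by
    ext i j
    change Z _ j = Z (r (b i)) j
    rw [hb]
  rwa [heq]

/-- The matrix merging the coordinates in each fibre of `φ`, with weights `w`. -/
def blockMatrix {m k : ℕ} (φ : Fin m → Fin k) (w : Fin m → ℝ) : Matrix (Fin m) (Fin k) ℝ :=
  Matrix.of fun j b => if φ j = b then w j else 0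

theorem blockMatrix_mulVec {m k : ℕ} (φ : Fin m → Fin k) (w : Fin m → ℝ) (c : Fin k → ℝ)
    (j : Fin m) : (blockMatrix φ w).mulVec c j = w j * c (φ j) := by
  simp [blockMatrix, Matrix.mulVec, dotProduct]

theorem mul_blockMatrix_eq_submatrix {n m k : ℕ} (X : Matrix (Fin n) (Fin m) ℝ)
    {φ : Fin m → Fin k} {w : Fin m → ℝ} {g : Fin k → Fin m} (hφ : ∀ b, φ (g b) = b)
    (hw : ∀ b, w (g b) = 1) (hw' : ∀ j, (∀ b, g b ≠ j) → w j = 0) :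
    X * blockMatrix φ w = X.submatrix id g := by
  ext i b
  rw [Matrix.mul_apply, Finset.sum_eq_single (g b)]
  · simp [blockMatrix, hφ, hw]
  · intro j _ hj
    by_cases h : ∃ b', g b' = j
    · obtain ⟨b', rfl⟩ := h
      have : b' ≠ b := by rintro rfl; exact hj rfl
      simp [blockMatrix, hφ, this]
    · simp [blockMatrix, hw' j (not_exists.mp h)]
  · simp

theorem AlternatesAlong.le_variation {n k : ℕ} {y : Fin n → ℝ} {T : Fin (k + 1) → Fin n}
    (hk : 1 ≤ k) (h : AlternatesAlong y T) : (k : ℤ) ≤ variation y := by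
  by_contra! hc
  obtain ⟨s, ε, hε, -, hstep, hlt, hsign⟩ := exists_sign_blocks_of_variation_lt hk hc
  have hmono : Monotone s := monotone_nat_of_le_succ fun j => (hstep j).1
  have hT : StrictMono fun b => (⟨s (T b), hlt _⟩ : Fin k) := by
    rw [Fin.strictMono_iff_lt_succ]
    intro b
    refine lt_of_le_of_ne (hmono (h.1.monotone (Fin.castSucc_lt_succ).le)) fun heq => ?_
    have heq' : s (T b.castSucc) = s (T b.succ) := congrArg Fin.val heq
    have h1 := mul_nonneg (hsign (T b.castSucc)) (hsign (T b.succ))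
    rw [heq'] at h1
    have h2 := h.mul_neg b
    have h3 : 0 < (ε * (-1) ^ s (T b.succ)) ^ 2 := by
      rcases hε with rfl | rfl <;> positivity
    nlinarith
  simpa using Fintype.card_le_of_injective _ hT.injective

theorem VB.not_alternatesAlong {n m k : ℕ} {X : Matrix (Fin n) (Fin m) ℝ} (hk : 1 ≤ k)
    (hX : VB X (k - 1)) {φ : Fin m → Fin k} (hφ : Monotone φ) {w : Fin m → ℝ}
    (hw : ∀ j, 0 ≤ w j) (c : Fin k → ℝ) (T : Fin (k + 1) → Fin n) :
    ¬ AlternatesAlong ((X * blockMatrix φ w).mulVec c) T := by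
  intro hT
  rw [← Matrix.mulVec_mulVec] at hT
  by_cases hu : (blockMatrix φ w).mulVec c = 0
  · obtain ⟨-, ε, hε⟩ := hT
    simpa [hu] using hε 0
  · have h1 := variation_lt_of_blocks hφ hw (blockMatrix_mulVec φ w c)
    have h2 := hX _ hu (by omega)
    have h3 := hT.le_variation hk
    omega

theorem det_mul_submatrix {n m k : ℕ} (X : Matrix (Fin n) (Fin m) ℝ)
    (D : Matrix (Fin m) (Fin k) ℝ) (f : Fin k → Fin n) :
    ((X * D).submatrix f id).det
      = ∑ g : Fin k → Fin m, (∏ b, D (g b) b) * (X.submatrix f g).det := by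
  have h : ((X * D).submatrix f id).transpose
      = fun b => ∑ j, D j b • fun a => X (f a) j := by
    ext b a
    simp [Matrix.mul_apply, mul_comm]
  rw [← Matrix.det_transpose, h]
  change Matrix.detRowAlternating.toMultilinearMap _ = _
  rw [MultilinearMap.map_sum]
  refine Finset.sum_congr rfl fun g _ => ?_
  rw [MultilinearMap.map_smul_univ, smul_eq_mul, ← Matrix.det_transpose (X.submatrix f g)]
  rfl

/-- A vector of variation less than `k` is constant in sign on each block of some partition of its
index set into `k` nonempty consecutive blocks. -/
theorem exists_surjective_blocks {m k : ℕ} (hk : 1 ≤ k) (hkm : k ≤ m) {u : Fin m → ℝ}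
    (hu : variation u < k) :
    ∃ φ : Fin m → Fin k, Monotone φ ∧ Function.Surjective φ ∧
      ∃ c : Fin k → ℝ, ∀ j, u j = |u j| * c (φ j) := by
  obtain ⟨s, ε, hε, h0, hstep, hlt, hsign⟩ := exists_sign_blocks_of_variation_lt hk hu
  have hmono : Monotone s := monotone_nat_of_le_succ fun j => (hstep j).1
  set p : ℕ → ℕ := fun j => max (s j) (j - (m - k)) with hp
  have hpmono : Monotone p := fun i j hij =>
    max_le_max (hmono hij) (Nat.sub_le_sub_right hij _)
  have hplt : ∀ j : Fin m, p j < k := fun j => max_lt (hlt _) (by omega)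
  have hpex : ∀ j, ∀ b ≤ p j, ∃ i ≤ j, p i = b := by
    intro j
    induction j with
    | zero =>
      intro b hb
      have : p 0 = 0 := by simp [hp, h0]
      exact ⟨0, le_rfl, by omega⟩
    | succ j ih =>
      intro b hb
      by_cases h : b ≤ p j
      · obtain ⟨i, hi, hib⟩ := ih b h
        exact ⟨i, by omega, hib⟩
      · refine ⟨j + 1, le_rfl, ?_⟩
        have := (hstep j).2
        simp only [hp] at *
        omega
  have hs : ∀ i j, p i = p j → s i = s j := by
    have key : ∀ i j, i ≤ j → p i = p j → s i = s j := by
      intro i j hij h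
      rcases hij.eq_or_lt with rfl | hlt'
      · rfl
      · have := hmono hij
        simp only [hp] at h
        omega
    intro i j h
    rcases le_total i j with hij | hij
    · exact key i j hij h
    · exact (key j i hij h.symm).symm
  have hsurj : Function.Surjective fun j : Fin m => (⟨p j, hplt j⟩ : Fin k) := by
    intro b
    have hb : (b : ℕ) ≤ p (m - 1) := by
      simp only [hp]
      omega
    obtain ⟨i, hi, hib⟩ := hpex (m - 1) b hb
    exact ⟨⟨i, by omega⟩, Fin.ext hib⟩
  refine ⟨fun j => ⟨p j, hplt j⟩, fun i j hij => hpmono (Fin.le_def.mp hij), hsurj, ?_⟩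
  choose g hg using hsurj
  refine ⟨fun b => ε * (-1) ^ s (g b), fun j => ?_⟩
  have hgj : s (g ⟨p j, hplt j⟩) = s j := hs _ _ (congrArg Fin.val (hg ⟨p j, hplt j⟩))
  have h := hsign j
  simp only [hgj]
  have he : ε * (-1) ^ s j = 1 ∨ ε * (-1) ^ s j = -1 := by
    rcases hε with rfl | rfl <;> rcases neg_one_pow_eq_or ℝ (s j) with h | h <;> simp [h]
  rcases he with he | he <;> rw [he] at h ⊢
  · rw [abs_of_nonneg (by linarith), mul_one]
  · rw [abs_of_nonpos (by linarith)]; ring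

theorem mulVec_submatrix_id {n m k : ℕ} (X : Matrix (Fin n) (Fin m) ℝ) (g : Fin k → Fin m)
    (c : Fin k → ℝ) : (X.submatrix id g).mulVec c = ∑ b, c b • X.transpose (g b) := by
  ext i
  simp [Matrix.mulVec, dotProduct, mul_comm]

theorem mulVec_submatrix_eq_zero {n m k : ℕ} {X : Matrix (Fin n) (Fin m) ℝ} {g : Fin k → Fin m}
    (hli : LinearIndependent ℝ fun b => X.transpose (g b)) (c : Fin k → ℝ)
    (hc : (X.submatrix id g).mulVec c = 0) : c = 0 := by
  rw [mulVec_submatrix_id] at hc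
  exact funext (Fintype.linearIndependent_iff.mp hli c hc)

theorem eq_zero_of_mulVec_eq_zero_of_support {n m : ℕ} {X : Matrix (Fin n) (Fin m) ℝ}
    {ι : Type*} [Fintype ι] {g : ι → Fin m} (hg : Function.Injective g)
    (hli : LinearIndependent ℝ fun b => X.transpose (g b)) {u : Fin m → ℝ}
    (hu : ∀ j, (∀ b, g b ≠ j) → u j = 0) (hX : X.mulVec u = 0) (b : ι) : u (g b) = 0 := by
  refine Fintype.linearIndependent_iff.mp hli (fun b => u (g b)) ?_ b
  have h : X.mulVec u = ∑ j, u j • X.transpose j := by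
    ext i
    simp [Matrix.mulVec, dotProduct, mul_comm]
  rw [← hX, h]
  refine Fintype.sum_of_injective g hg _ _ (fun j hj => ?_) (fun _ => rfl)
  rw [hu j (fun b hb => hj ⟨b, hb⟩), zero_smul]

theorem SC.vb {n m k : ℕ} {X : Matrix (Fin n) (Fin m) ℝ} (hk : 1 ≤ k) (hkm : k ≤ m)
    (hli : ∀ g : Fin k → Fin m, Function.Injective g →
      LinearIndependent ℝ (fun i : Fin k => X.transpose (g i)))
    (hX : SC X k) : VB X (k - 1) := by
  obtain ⟨τ, hτ, hminor⟩ : ∃ τ : ℝ, τ ≠ 0 ∧ ∀ (f : Fin k → Fin n) (g : Fin k → Fin m),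
      StrictMono f → StrictMono g → 0 ≤ τ * (X.submatrix f g).det := by
    rcases hX with h | h
    · exact ⟨1, one_ne_zero, fun f g hf hg => by simpa using h f g hf hg⟩
    · exact ⟨-1, by norm_num, fun f g hf hg => by simpa using h f g hf hg⟩
  intro u _ hu
  by_contra! hc
  obtain ⟨T, hT⟩ := exists_alternatesAlong_of_le_variation (k := k) (y := X.mulVec u) (by omega)
  obtain ⟨φ, hφ, hsurj, c, huc⟩ := exists_surjective_blocks hk hkm (u := u) (by omega)
  have hev : ∀ᶠ t in nhds (0 : ℝ),
      AlternatesAlong (X.mulVec fun j => (|u j| + t) * c (φ j)) T := by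
    refine AlternatesAlong.eventually (fun i => ?_) ?_
    · simp only [Matrix.mulVec, dotProduct]
      fun_prop
    · simpa only [add_zero, ← huc] using hT
  obtain ⟨t, ht, htT⟩ := hev.exists_pos
  set w : Fin m → ℝ := fun j => |u j| + t with hw
  have hwpos : ∀ j, 0 < w j := fun j => by positivity
  have hcol : ((X * blockMatrix φ w).mulVec c) = X.mulVec fun j => (|u j| + t) * c (φ j) := by
    rw [← Matrix.mulVec_mulVec]
    congr 1
    exact funext fun j => blockMatrix_mulVec φ w c j
  have hterm : ∀ f : Fin k → Fin n, StrictMono f → ∀ g : Fin k → Fin m,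
      0 ≤ (∏ b, blockMatrix φ w (g b) b) * (τ * (X.submatrix f g).det) := by
    intro f hf g
    by_cases hg : ∀ b, φ (g b) = b
    · refine mul_nonneg (Finset.prod_nonneg fun b _ => ?_) (hminor f g hf fun a b hab => ?_)
      · simpa [blockMatrix, hg] using (hwpos _).le
      · by_contra hle
        have := hφ (not_lt.mp hle)
        rw [hg, hg] at this
        exact absurd hab (not_lt.mpr this)
    · push Not at hg
      obtain ⟨b, hb⟩ := hg
      rw [Finset.prod_eq_zero (Finset.mem_univ b) (by simp [blockMatrix, hb]), zero_mul]
  have hexp : ∀ f : Fin k → Fin n, τ * ((X * blockMatrix φ w).submatrix f id).det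
      = ∑ g : Fin k → Fin m, (∏ b, blockMatrix φ w (g b) b) * (τ * (X.submatrix f g).det) := by
    intro f
    rw [det_mul_submatrix, Finset.mul_sum]
    exact Finset.sum_congr rfl fun g _ => by ring
  have hnonneg : ∀ f : Fin k → Fin n, StrictMono f →
      0 ≤ τ * ((X * blockMatrix φ w).submatrix f id).det := fun f hf => by
    rw [hexp]
    exact Finset.sum_nonneg fun g _ => hterm f hf g
  choose g hg using hsurj
  have hginj : Function.Injective g := fun a b hab => by rw [← hg a, ← hg b, hab]
  have hgmono : StrictMono g := fun a b hab => by
    by_contra hle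
    have := hφ (not_lt.mp hle)
    rw [hg, hg] at this
    exact absurd hab (not_lt.mpr this)
  obtain ⟨f, hf, hdet⟩ := exists_minor_ne_zero (mulVec_submatrix_eq_zero (hli g hginj))
  refine not_alternatesAlong_of_minors_nonneg hnonneg hf ?_ c T (hcol ▸ htT)
  rw [hexp]
  refine Finset.sum_pos' (fun g _ => hterm f hf g) ⟨g, Finset.mem_univ _, mul_pos ?_ ?_⟩
  · exact Finset.prod_pos fun b _ => by simpa [blockMatrix, hg] using hwpos _
  · refine lt_of_le_of_ne (hminor f g hf hgmono) (Ne.symm (mul_ne_zero hτ ?_))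
    simpa using hdet

/-- Along a continuous path of nonnegative block weights whose merged columns stay independent, the
sign of the maximal minors of the merged matrix does not change. -/
theorem VB.minor_nonneg_of_path {n m k : ℕ} {X : Matrix (Fin n) (Fin m) ℝ} (hk : 1 ≤ k)
    (hX : VB X (k - 1)) {φ : Fin m → Fin k} (hφ : Monotone φ) {w : ℝ → Fin m → ℝ}
    (hcont : ∀ j, Continuous fun t => w t j) (hw : ∀ t ∈ Set.Icc (0 : ℝ) 1, ∀ j, 0 ≤ w t j)
    (hfull : ∀ t ∈ Set.Icc (0 : ℝ) 1, ∀ c, (X * blockMatrix φ (w t)).mulVec c = 0 → c = 0)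
    {τ : ℝ} {f h : Fin k → Fin n} (hf : StrictMono f) (hh : StrictMono h)
    (hpos : 0 < τ * ((X * blockMatrix φ (w 1)).submatrix f id).det) :
    0 ≤ τ * ((X * blockMatrix φ (w 0)).submatrix h id).det := by
  by_contra! hneg
  set D : (Fin k → Fin n) → ℝ → ℝ :=
    fun f t => τ * ((X * blockMatrix φ (w t)).submatrix f id).det with hD
  have hDcont : ∀ f, Continuous (D f) := by
    intro f
    refine continuous_const.mul (Continuous.matrix_det (Continuous.matrix_submatrix ?_ _ _))
    refine continuous_const.matrix_mul (continuous_matrix fun j b => ?_)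
    simp only [blockMatrix, Matrix.of_apply]
    split_ifs
    · exact hcont j
    · exact continuous_const
  have hclosed : ∀ s : ℝ, IsClosed {t | ∀ f, StrictMono f → 0 ≤ s * D f t} := by
    intro s
    simp only [Set.ofPred_forall]
    exact isClosed_iInter fun f => isClosed_iInter fun _ =>
      isClosed_le continuous_const (continuous_const.mul (hDcont f))
  have hτ : τ ≠ 0 := by rintro rfl; simp at hpos
  have hsame : ∀ t ∈ Set.Icc (0 : ℝ) 1, ∀ (s : ℝ) (f h : Fin k → Fin n), StrictMono f →
      StrictMono h → 0 < s * D f t → 0 ≤ s * D h t := by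
    intro t ht s f h hf hh hp
    simp only [hD, ← mul_assoc] at hp ⊢
    exact minor_nonneg_of_not_alternatesAlong (hX.not_alternatesAlong hk hφ (hw t ht)) hf hh hp
  have h0 : (0 : ℝ) ∈ Set.Icc (0 : ℝ) 1 := by simp
  have h1 : (1 : ℝ) ∈ Set.Icc (0 : ℝ) 1 := by simp
  obtain ⟨t, ht, htA, htB⟩ := isPreconnected_closed_iff.mp isPreconnected_Icc _ _
    (hclosed 1) (hclosed (-1))
    (fun t ht => by
      by_cases hall : ∀ f, StrictMono f → 0 ≤ 1 * D f t
      · exact Or.inl hall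
      · push Not at hall
        obtain ⟨f, hf, hft⟩ := hall
        exact Or.inr fun h hh => hsame t ht (-1) f h hf hh (by linarith))
    ⟨1, h1, fun h hh => hsame 1 h1 1 f h hf hh (by rwa [one_mul])⟩
    ⟨0, h0, fun f hf => hsame 0 h0 (-1) h f hh hf (by linarith)⟩
  obtain ⟨f, hf, hdet⟩ := exists_minor_ne_zero (hfull t ht)
  refine mul_ne_zero hτ hdet (le_antisymm ?_ ?_)
  · have := htB f hf
    simp only [hD] at this
    linarith
  · have := htA f hf
    simp only [hD] at this
    linarith

/-- The blocks starting at the values of `g`. -/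
theorem exists_monotone_block_map {m k : ℕ} (hk : 1 ≤ k) (g : Fin k → Fin m) :
    ∃ φ : Fin m → Fin k, Monotone φ ∧ ∀ v a, (∀ b, g b ≤ v ↔ b ≤ a) → φ v = a := by
  have hle : ∀ j, (Finset.univ.filter fun b => g b ≤ j).card ≤ k := fun j =>
    (Finset.card_le_univ _).trans_eq (Fintype.card_fin k)
  refine ⟨fun j => ⟨(Finset.univ.filter fun b => g b ≤ j).card - 1, by have := hle j; omega⟩,
    fun i j hij => ?_, fun v a hva => ?_⟩
  · refine Fin.le_def.mpr (Nat.sub_le_sub_right (Finset.card_le_card fun b hb => ?_) 1)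
    simp only [Finset.mem_filter, Finset.mem_univ, true_and] at hb ⊢
    exact hb.trans hij
  · have : (Finset.univ.filter fun b => g b ≤ v) = Finset.Iic a := by
      ext b
      simp [hva]
    simp [this]

/-- Weights interpolating between the columns `g` (at `t = 1`) and `Function.update g a v`
(at `t = 0`), with the columns in `E` switched on in between. -/
noncomputable def pathWeight {m k : ℕ} (g : Fin k → Fin m) (a : Fin k) (v : Fin m)
    (E : Finset (Fin m)) (t : ℝ) (j : Fin m) : ℝ :=
  open Classical in
  if j = v then 1 - t else if j = g a then t else if ∃ b, g b = j then 1 else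
    if j ∈ E then t * (1 - t) else 0

theorem continuous_pathWeight {m k : ℕ} (g : Fin k → Fin m) (a : Fin k) (v : Fin m)
    (E : Finset (Fin m)) (j : Fin m) : Continuous fun t => pathWeight g a v E t j := by
  unfold pathWeight
  split_ifs <;> fun_prop

theorem pathWeight_nonneg {m k : ℕ} (g : Fin k → Fin m) (a : Fin k) (v : Fin m)
    (E : Finset (Fin m)) {t : ℝ} (ht : t ∈ Set.Icc (0 : ℝ) 1) (j : Fin m) :
    0 ≤ pathWeight g a v E t j := by
  obtain ⟨h0, h1⟩ := ht
  unfold pathWeight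
  split_ifs
  · linarith
  · exact h0
  · exact zero_le_one
  · exact mul_nonneg h0 (by linarith)
  · exact le_rfl

theorem pathWeight_pos {m k : ℕ} (g : Fin k → Fin m) (a : Fin k) (v : Fin m)
    (E : Finset (Fin m)) {t : ℝ} (ht : t ∈ Set.Ioo (0 : ℝ) 1) {j : Fin m}
    (hj : j = v ∨ (∃ b, g b = j) ∨ j ∈ E) : 0 < pathWeight g a v E t j := by
  obtain ⟨h0, h1⟩ := ht
  unfold pathWeight
  split_ifs
  · linarith
  · exact h0
  · exact zero_lt_one
  · exact mul_pos h0 (by linarith)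
  · tauto

theorem pathWeight_eq_zero {m k : ℕ} {g : Fin k → Fin m} {a : Fin k} {v : Fin m}
    {E : Finset (Fin m)} (t : ℝ) {j : Fin m} (hv : j ≠ v) (hg : ∀ b, g b ≠ j) (hE : j ∉ E) :
    pathWeight g a v E t j = 0 := by
  have : j ≠ g a := (hg a).symm
  simp [pathWeight, hv, hg, hE, this]

theorem mul_blockMatrix_pathWeight_one {n m k : ℕ} (X : Matrix (Fin n) (Fin m) ℝ)
    {g : Fin k → Fin m} {a : Fin k} {v : Fin m} (E : Finset (Fin m)) {φ : Fin m → Fin k}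
    (hφ : ∀ b, φ (g b) = b) (hr : ∀ b, g b ≠ v) :
    X * blockMatrix φ (pathWeight g a v E 1) = X.submatrix id g := by
  refine mul_blockMatrix_eq_submatrix X hφ (fun b => ?_) (fun j hj => ?_)
  · simp [pathWeight, hr]
  · have : j ≠ g a := (hj a).symm
    simp [pathWeight, hj, this]

theorem mul_blockMatrix_pathWeight_zero {n m k : ℕ} (X : Matrix (Fin n) (Fin m) ℝ)
    {g : Fin k → Fin m} (hg : Function.Injective g) {a : Fin k} {v : Fin m} (E : Finset (Fin m))
    {φ : Fin m → Fin k} (hφ : ∀ b, φ (g b) = b) (hφv : φ v = a) (hr : ∀ b, g b ≠ v) :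
    X * blockMatrix φ (pathWeight g a v E 0) = X.submatrix id (Function.update g a v) := by
  refine mul_blockMatrix_eq_submatrix X (fun b => ?_) (fun b => ?_) (fun j hj => ?_)
  · by_cases hb : b = a
    · subst hb; simpa using hφv
    · simp [hb, hφ]
  · by_cases hb : b = a
    · subst hb; simp [pathWeight]
    · simp [pathWeight, hb, hr, hg.eq_iff]
  · have h1 : j ≠ v := by simpa using (hj a).symm
    by_cases h2 : j = g a
    · simp [pathWeight, h2, hr]
    · have h3 : ∀ b, g b ≠ j := fun b hb => by
        have hba : b ≠ a := by rintro rfl; exact h2 hb.symm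
        exact hj b (by simpa [hba] using hb)
      simp [pathWeight, h1, h2, h3]

/-- For a suitable choice of auxiliary columns the merged columns along the path stay linearly
independent. -/
theorem exists_pathWeight_injective {n m k : ℕ} {X : Matrix (Fin n) (Fin m) ℝ}
    (hrk : k < X.rank)
    (hli : ∀ g : Fin k → Fin m, Function.Injective g →
      LinearIndependent ℝ (fun i : Fin k => X.transpose (g i)))
    {g : Fin k → Fin m} (hg : Function.Injective g) {a : Fin k} {v : Fin m}
    (hr : ∀ b, g b ≠ v) {φ : Fin m → Fin k} (hφ : ∀ b, φ (g b) = b) :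
    ∃ E : Finset (Fin m), ∀ t ∈ Set.Ioo (0 : ℝ) 1, ∀ c,
      (X * blockMatrix φ (pathWeight g a v E t)).mulVec c = 0 → c = 0 := by
  set C : Fin (k + 1) → Fin m := Fin.cons v g with hC
  have hCinj : Function.Injective C :=
    Fin.cons_injective_iff.mpr ⟨fun ⟨b, hb⟩ => hr b hb, hg⟩
  have hCmem : ∀ j, (∀ b, C b ≠ j) → j ≠ v ∧ ∀ b, g b ≠ j := fun j hj =>
    ⟨(hj 0).symm, fun b => by simpa [hC] using hj b.succ⟩
  set S := Submodule.span ℝ (Set.range fun b => X.transpose (C b)) with hS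
  by_cases hall : ∀ e, X.transpose e ∈ S
  · have hCli : LinearIndependent ℝ fun b => X.transpose (C b) := by
      rw [linearIndependent_iff_card_le_finrank_span, Fintype.card_fin]
      refine hrk.trans_le ?_
      rw [Matrix.rank_eq_finrank_span_cols]
      exact Submodule.finrank_mono (Submodule.span_le.mpr (Set.range_subset_iff.mpr hall))
    refine ⟨∅, fun t ht c hc => ?_⟩
    rw [← Matrix.mulVec_mulVec] at hc
    have hu := eq_zero_of_mulVec_eq_zero_of_support hCinj hCli (fun j hj => by
      rw [blockMatrix_mulVec, pathWeight_eq_zero t (hCmem j hj).1 (hCmem j hj).2 (by simp),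
        zero_mul]) hc
    refine funext fun b => ?_
    have hb := hu b.succ
    rw [blockMatrix_mulVec, hC, Fin.cons_succ, hφ] at hb
    exact (mul_eq_zero.mp hb).resolve_left
      (pathWeight_pos g a v ∅ ht (Or.inr (Or.inl ⟨b, rfl⟩))).ne'
  · push Not at hall
    obtain ⟨e, he⟩ := hall
    refine ⟨{e}, fun t ht c hc => ?_⟩
    rw [← Matrix.mulVec_mulVec] at hc
    set u := (blockMatrix φ (pathWeight g a v {e} t)).mulVec c with hu
    have huj : ∀ j, u j = pathWeight g a v {e} t j * c (φ j) := blockMatrix_mulVec _ _ _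
    have hsupp : ∀ j, j ≠ v → (∀ b, g b ≠ j) → j ≠ e → u j = 0 := fun j h1 h2 h3 => by
      rw [huj, pathWeight_eq_zero t h1 h2 (by simpa using h3), zero_mul]
    have hue : u e = 0 := by
      by_contra hne
      have hsum : X.mulVec u = ∑ j, u j • X.transpose j := by
        ext i
        simp [Matrix.mulVec, dotProduct, mul_comm]
      rw [hsum, ← Finset.add_sum_erase _ _ (Finset.mem_univ e)] at hc
      refine he ((Submodule.smul_mem_iff S hne).mp ?_)
      rw [eq_neg_of_add_eq_zero_left hc]
      refine S.neg_mem (S.sum_mem fun j hj => ?_)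
      by_cases hjC : ∃ b, C b = j
      · obtain ⟨b, rfl⟩ := hjC
        exact S.smul_mem _ (Submodule.subset_span ⟨b, rfl⟩)
      · obtain ⟨h1, h2⟩ := hCmem j (not_exists.mp hjC)
        rw [hsupp j h1 h2 (Finset.ne_of_mem_erase hj), zero_smul]
        exact S.zero_mem
    have hce : c (φ e) = 0 := by
      rw [huj] at hue
      exact (mul_eq_zero.mp hue).resolve_left
        (pathWeight_pos g a v {e} ht (Or.inr (Or.inr (by simp)))).ne'
    have hinj : Function.Injective (Function.update g (φ e) v) := by
      intro b b' hbb
      simp only [Function.update_apply] at hbb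
      split_ifs at hbb with h1 h2 h2
      · rw [h1, h2]
      · exact absurd hbb.symm (hr _)
      · exact absurd hbb (hr _)
      · exact hg hbb
    have h := eq_zero_of_mulVec_eq_zero_of_support hinj (hli _ hinj) (fun j hj => by
      by_cases hje : j = e
      · rw [hje, hue]
      by_cases hjg : ∃ b, g b = j
      · obtain ⟨b, rfl⟩ := hjg
        have hb : b = φ e := by
          by_contra hb
          exact hj b (by simp [hb])
        rw [huj, hφ, hb, hce, mul_zero]
      · exact hsupp j (by simpa using (hj (φ e)).symm) (not_exists.mp hjg) hje) hc
    refine funext fun b => ?_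
    by_cases hb : b = φ e
    · rw [hb, hce]; rfl
    · have hub := h b
      rw [Function.update_of_ne hb, huj, hφ] at hub
      exact (mul_eq_zero.mp hub).resolve_left
        (pathWeight_pos g a v {e} ht (Or.inr (Or.inl ⟨b, rfl⟩))).ne'

theorem VB.minor_update_nonneg_of_eq_add_one {n m k : ℕ} {X : Matrix (Fin n) (Fin m) ℝ}
    (hk : 1 ≤ k) (hrk : k < X.rank)
    (hli : ∀ g : Fin k → Fin m, Function.Injective g →
      LinearIndependent ℝ (fun i : Fin k => X.transpose (g i)))
    (hX : VB X (k - 1)) {g : Fin k → Fin m} (hg : StrictMono g) {a : Fin k} {v : Fin m}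
    (hv : (v : ℕ) = g a + 1) (hr : ∀ b, g b ≠ v) {τ : ℝ} {f h : Fin k → Fin n}
    (hf : StrictMono f) (hh : StrictMono h) (hpos : 0 < τ * (X.submatrix f g).det) :
    0 ≤ τ * (X.submatrix h (Function.update g a v)).det := by
  obtain ⟨φ, hφ, hφinv⟩ := exists_monotone_block_map hk g
  have hφg : ∀ b, φ (g b) = b := fun b => hφinv _ _ fun _ => hg.le_iff_le
  have hφv : φ v = a := hφinv v a fun b => by
    have := Fin.val_ne_of_ne (hr b)
    rw [← hg.le_iff_le, Fin.le_def, Fin.le_def]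
    omega
  obtain ⟨E, hE⟩ := exists_pathWeight_injective (a := a) hrk hli hg.injective hr hφg
  have h1 := mul_blockMatrix_pathWeight_one X (a := a) E hφg hr
  have h0 := mul_blockMatrix_pathWeight_zero X hg.injective E hφg hφv hr
  have hpath := hX.minor_nonneg_of_path hk hφ (w := pathWeight g a v E)
    (continuous_pathWeight g a v E) (fun t ht => pathWeight_nonneg g a v E ht) (fun t ht c hc => by
      rcases ht.1.eq_or_lt with rfl | ht0
      · rw [h0] at hc
        exact mulVec_submatrix_eq_zero
          (hli _ (hg.update_of_adjacent (Or.inl hv) hr).injective) c hc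
      rcases ht.2.eq_or_lt with rfl | ht1
      · rw [h1] at hc
        exact mulVec_submatrix_eq_zero (hli _ hg.injective) c hc
      exact hE t ⟨ht0, ht1⟩ c hc) (τ := τ) hf hh
  rw [h0, h1] at hpath
  simpa using hpath (by simpa using hpos)

theorem VB.minor_update_nonneg {n m k : ℕ} {X : Matrix (Fin n) (Fin m) ℝ}
    (hk : 1 ≤ k) (hrk : k < X.rank)
    (hli : ∀ g : Fin k → Fin m, Function.Injective g →
      LinearIndependent ℝ (fun i : Fin k => X.transpose (g i)))
    (hX : VB X (k - 1)) {g : Fin k → Fin m} (hg : StrictMono g) {a : Fin k} {v : Fin m}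
    (hv : (v : ℕ) = g a + 1 ∨ (g a : ℕ) = v + 1) (hr : ∀ b, g b ≠ v) {τ : ℝ}
    {f h : Fin k → Fin n} (hf : StrictMono f) (hh : StrictMono h)
    (hpos : 0 < τ * (X.submatrix f g).det) :
    0 ≤ τ * (X.submatrix h (Function.update g a v)).det := by
  rcases hv with hv | hv
  · exact hX.minor_update_nonneg_of_eq_add_one hk hrk hli hg hv hr hf hh hpos
  · by_contra! hneg
    have h := hX.minor_update_nonneg_of_eq_add_one hk hrk hli (τ := -τ)
      (hg.update_of_adjacent (Or.inr hv) hr) (a := a) (v := g a) (by simpa using hv)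
      (fun b => by
        by_cases hb : b = a
        · subst hb; simpa using (hr b).symm
        · simpa [hb] using hg.injective.ne hb) hh hf (by linarith)
    rw [Function.update_idem, Function.update_eq_self] at h
    linarith

theorem VB.submatrix_not_alternatesAlong {n m k : ℕ} {X : Matrix (Fin n) (Fin m) ℝ} (hk : 1 ≤ k)
    (hX : VB X (k - 1)) {g : Fin k → Fin m} (hg : StrictMono g) (c : Fin k → ℝ)
    (T : Fin (k + 1) → Fin n) : ¬ AlternatesAlong ((X.submatrix id g).mulVec c) T := by
  classical
  obtain ⟨φ, hφ, hφinv⟩ := exists_monotone_block_map hk g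
  rw [← mul_blockMatrix_eq_submatrix X (φ := φ) (w := fun j => if ∃ b, g b = j then 1 else 0)
    (fun b => hφinv _ _ fun _ => hg.le_iff_le) (by simp) (fun j hj => by simp [hj])]
  exact hX.not_alternatesAlong hk hφ (fun j => by split_ifs <;> norm_num) c T

theorem VB.minor_nonneg {n m k : ℕ} {X : Matrix (Fin n) (Fin m) ℝ}
    (hk : 1 ≤ k) (hrk : k < X.rank)
    (hli : ∀ g : Fin k → Fin m, Function.Injective g →
      LinearIndependent ℝ (fun i : Fin k => X.transpose (g i)))
    (hX : VB X (k - 1)) {f f' : Fin k → Fin n} {g g' : Fin k → Fin m} (hf : StrictMono f)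
    (hf' : StrictMono f') (hg : StrictMono g) (hg' : StrictMono g')
    (hpos : 0 < (X.submatrix f g).det) : 0 ≤ (X.submatrix f' g').det := by
  by_contra! hneg
  induction hN : indexDist g g' using Nat.strong_induction_on generalizing f g with
  | _ N ih =>
  by_cases hgg : g = g'
  · subst hgg
    have h := minor_nonneg_of_not_alternatesAlong (Z := X.submatrix id g) (τ := 1)
      (hX.submatrix_not_alternatesAlong hk hg) hf hf' (by simpa using hpos)
    have h' : 0 ≤ (X.submatrix f' g).det := by simpa using h
    linarith
  · obtain ⟨a, v, hav, hv, hlt⟩ := exists_adjacent_indexDist_lt hg hg' hgg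
    have hg₁ := hg.update_of_adjacent hav hv
    obtain ⟨f₁, hf₁, hdet⟩ := exists_minor_ne_zero (mulVec_submatrix_eq_zero
      (hli _ hg₁.injective))
    have hdet' : (X.submatrix f₁ (Function.update g a v)).det ≠ 0 := by simpa using hdet
    have hnonneg := hX.minor_update_nonneg hk hrk hli hg hav hv (τ := 1) hf hf₁
      (by simpa using hpos)
    rw [one_mul] at hnonneg
    exact ih _ (hN ▸ hlt) hf₁ hg₁ (lt_of_le_of_ne hnonneg hdet'.symm) rfl

/-- if `1 ≤ k < rank X` and every `k` columns of `X` are linearly independent,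
then `X` is `(k-1)`-variation bounding iff `X` is `k`-sign consistent. -/
theorem stmt5 {n m : ℕ} (X : Matrix (Fin n) (Fin m) ℝ) (k : ℕ)
    (hk : 1 ≤ k) (hkrk : k < X.rank)
    (hli : ∀ g : Fin k → Fin m, Function.Injective g →
      LinearIndependent ℝ (fun i : Fin k => X.transpose (g i))) :
    VB X (k - 1) ↔ SC X k := by
  refine ⟨fun hX => ?_, fun hX => hX.vb hk (hkrk.le.trans X.rank_le_width) hli⟩
  by_cases h : ∀ (f : Fin k → Fin n) (g : Fin k → Fin m), StrictMono f → StrictMono g →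
      0 ≤ (X.submatrix f g).det
  · exact Or.inl h
  · push Not at h
    obtain ⟨f', g', hf', hg', hneg⟩ := h
    refine Or.inr fun f g hf hg => ?_
    by_contra! hpos
    exact absurd hneg (not_lt.mpr (hX.minor_nonneg hk hkrk hli hf hf' hg hg' hpos))
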